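/- Let e = γ_0, γ_1, … be an execution of Algo_U, of Algo_B(D), or of Algo_HC(D). If for every vertex p the value d_p is modified only a finite number of times along e, then e is finite. -/

import Mathlib

open SimpleGraph

/-- A configuration: a distance value `d` and a parent pointer `par` per vertex. -/
structure Config (V : Type*) where
  d : V → ℕ
  par : V → V

/-- `Min_d(p)`: the minimum of the `d`-values of the neighbors of `p`. -/
noncomputable def minD {V : Type*} (G : SimpleGraph V) (γ : Config V) (p : V) : ℕ :=
  sInf (γ.d '' {q | G.Adj p q})

def dOk {V : Type*} (G : SimpleGraph V) (γ : Config V) (p : V) : Prop :=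
  γ.d p = minD G γ p + 1

def parOk {V : Type*} (γ : Config V) (p : V) : Prop :=
  γ.d p = γ.d (γ.par p) + 1

/-- A valid configuration of `Algo_U`: `d r = 0` and parent pointers are neighbors. -/
def ValidU {V : Type*} (G : SimpleGraph V) (r : V) (γ : Config V) : Prop :=
  γ.d r = 0 ∧ ∀ p, p ≠ r → G.Adj p (γ.par p)

/-- A valid configuration of the bounded algorithms: non-root `d`-values in `{1,…,D}`. -/
def ValidB {V : Type*} (G : SimpleGraph V) (r : V) (D : ℕ) (γ : Config V) : Prop :=
  γ.d r = 0 ∧ ∀ p, p ≠ r → G.Adj p (γ.par p) ∧ 1 ≤ γ.d p ∧ γ.d p ≤ D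

/-- Vertex `p` executes rule `U1` or `U2` in the step from `γ` to `γ'`:
`U1 : ¬dOk(p) → update(p)`, `U2 : dOk(p) ∧ ¬parOk(p) → par_p ← bestParent(p)`. -/
def execU {V : Type*} (G : SimpleGraph V) (γ γ' : Config V) (p : V) : Prop :=
  (¬ dOk G γ p ∧ γ'.d p = minD G γ p + 1 ∧
    G.Adj p (γ'.par p) ∧ γ.d (γ'.par p) = minD G γ p) ∨
  (dOk G γ p ∧ ¬ parOk γ p ∧ γ'.d p = γ.d p ∧
    G.Adj p (γ'.par p) ∧ γ.d (γ'.par p) = minD G γ p)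

/-- Vertex `p` executes one of the rules `B1`, `B2`, `B3` of `Algo_B(D)`. -/
def execB {V : Type*} (G : SimpleGraph V) (D : ℕ) (γ γ' : Config V) (p : V) : Prop :=
  (minD G γ p < D ∧ ¬ dOk G γ p ∧ γ'.d p = minD G γ p + 1 ∧
    G.Adj p (γ'.par p) ∧ γ.d (γ'.par p) = minD G γ p) ∨
  (minD G γ p < D ∧ dOk G γ p ∧ ¬ parOk γ p ∧ γ'.d p = γ.d p ∧
    G.Adj p (γ'.par p) ∧ γ.d (γ'.par p) = minD G γ p) ∨
  (minD G γ p = D ∧ γ.d p ≠ D ∧ γ'.d p = D ∧ γ'.par p = γ.par p)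

/-- Vertex `p` executes rule `HC1` or `HC2` of `Algo_HC(D)`. -/
def execHC {V : Type*} (G : SimpleGraph V) (D : ℕ) (γ γ' : Config V) (p : V) : Prop :=
  (¬ parOk γ p ∧ γ.d (γ.par p) < D ∧ γ'.d p = γ.d (γ.par p) + 1 ∧ γ'.par p = γ.par p) ∨
  (minD G γ p < γ.d (γ.par p) ∧ γ'.d p = minD G γ p + 1 ∧
    G.Adj p (γ'.par p) ∧ γ.d (γ'.par p) = minD G γ p)

/-- Vertex `p` executes rule `HC2`: `d_{par_p} > Min_d(p) → update(p)`. -/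
def execHC2 {V : Type*} (G : SimpleGraph V) (γ γ' : Config V) (p : V) : Prop :=
  minD G γ p < γ.d (γ.par p) ∧ γ'.d p = minD G γ p + 1 ∧
    G.Adj p (γ'.par p) ∧ γ.d (γ'.par p) = minD G γ p

/-- Vertex `p` executes rule `FHC1` or `HC2` of `Algo_FHC(D)`. -/
def execFHC {V : Type*} (G : SimpleGraph V) (D : ℕ) (γ γ' : Config V) (p : V) : Prop :=
  (¬ parOk γ p ∧ γ.d (γ.par p) < D ∧ γ.d (γ.par p) = minD G γ p ∧
    γ'.d p = γ.d (γ.par p) + 1 ∧ γ'.par p = γ.par p) ∨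
  execHC2 G γ γ' p

/-- A step of a distributed unfair daemon: a nonempty set `S` of (non-root) vertices,
each executing one of its enabled rules (as described by `exec`), all other vertices
keeping their state. -/
def StepWith {V : Type*} (r : V) (exec : Config V → Config V → V → Prop)
    (γ γ' : Config V) (S : Set V) : Prop :=
  S.Nonempty ∧ (∀ p ∈ S, p ≠ r ∧ exec γ γ' p) ∧
    ∀ p ∉ S, γ'.d p = γ.d p ∧ γ'.par p = γ.par p

def Step {V : Type*} (r : V) (exec : Config V → Config V → V → Prop)
    (γ γ' : Config V) : Prop :=
  ∃ S : Set V, StepWith r exec γ γ' S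

/-- Guard of the rules of `Algo_U` at `p`. -/
def guardU {V : Type*} (G : SimpleGraph V) (γ : Config V) (p : V) : Prop :=
  ¬ dOk G γ p ∨ (dOk G γ p ∧ ¬ parOk γ p)

/-- Guard of the rules of `Algo_B(D)` at `p`. -/
def guardB {V : Type*} (G : SimpleGraph V) (D : ℕ) (γ : Config V) (p : V) : Prop :=
  (minD G γ p < D ∧ ¬ dOk G γ p) ∨
  (minD G γ p < D ∧ dOk G γ p ∧ ¬ parOk γ p) ∨
  (minD G γ p = D ∧ γ.d p ≠ D)

/-- Guard of the rules of `Algo_HC(D)` at `p`. -/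
def guardHC {V : Type*} (G : SimpleGraph V) (D : ℕ) (γ : Config V) (p : V) : Prop :=
  (¬ parOk γ p ∧ γ.d (γ.par p) < D) ∨ minD G γ p < γ.d (γ.par p)

/-- Guard of the rules of `Algo_FHC(D)` at `p`. -/
def guardFHC {V : Type*} (G : SimpleGraph V) (D : ℕ) (γ : Config V) (p : V) : Prop :=
  (¬ parOk γ p ∧ γ.d (γ.par p) < D ∧ γ.d (γ.par p) = minD G γ p) ∨
  minD G γ p < γ.d (γ.par p)

/-- A vertex is enabled when it is not the root and one of its guards holds. -/
def Enabled {V : Type*} (r : V) (guard : Config V → V → Prop) (γ : Config V) (p : V) : Prop :=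
  p ≠ r ∧ guard γ p

/-- A terminal configuration: no vertex is enabled. -/
def Terminal {V : Type*} (r : V) (guard : Config V → V → Prop) (γ : Config V) : Prop :=
  ∀ p, ¬ Enabled r guard γ p

/-- An execution (padded by stuttering once a terminal configuration is reached, so
that maximality is automatic): `e i` is the `i`-th configuration and `M i` the set of
vertices selected by the daemon at step `i`. -/
def IsExec {V : Type*} (r : V) (valid : Config V → Prop)
    (exec : Config V → Config V → V → Prop) (guard : Config V → V → Prop)
    (e : ℕ → Config V) (M : ℕ → Set V) : Prop :=
  (∀ i, valid (e i)) ∧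
    ∀ i, (Terminal r guard (e i) ∧ e (i + 1) = e i ∧ M i = ∅) ∨
      StepWith r exec (e i) (e (i + 1)) (M i)

/-- Every vertex enabled in `e s` executes a rule or becomes neutralized in some step
`j` with `s ≤ j < t`. -/
def Covers {V : Type*} (r : V) (guard : Config V → V → Prop)
    (e : ℕ → Config V) (M : ℕ → Set V) (s t : ℕ) : Prop :=
  ∀ p, Enabled r guard (e s) p →
    ∃ j, s ≤ j ∧ j < t ∧
      (p ∈ M j ∨ (Enabled r guard (e j) p ∧ ¬ Enabled r guard (e (j + 1)) p))

/-- `t` is the end of the round of execution `(e, M)` starting at index `s`: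
the prefix from `s` to `t` is the minimal one in which every vertex enabled at `e s`
executes a rule or is neutralized. -/
def RoundEnd {V : Type*} (r : V) (guard : Config V → V → Prop)
    (e : ℕ → Config V) (M : ℕ → Set V) (s t : ℕ) : Prop :=
  s ≤ t ∧ Covers r guard e M s t ∧ ∀ u, s ≤ u → Covers r guard e M s u → t ≤ u

theorem minD_le_of_adj {V : Type*} {G : SimpleGraph V} {γ : Config V} {p q : V}
    (h : G.Adj p q) : minD G γ p ≤ γ.d q :=
  Nat.sInf_le ⟨q, h, rfl⟩

theorem execU_par_lt {V : Type*} {G : SimpleGraph V} {γ γ' : Config V} {p : V}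
    (hpar : G.Adj p (γ.par p)) (hd : γ'.d p = γ.d p) (h : execU G γ γ' p) :
    γ.d (γ'.par p) < γ.d (γ.par p) := by
  have := minD_le_of_adj (γ := γ) hpar
  unfold execU dOk parOk at h
  omega

theorem execB_par_lt {V : Type*} {G : SimpleGraph V} {D : ℕ} {γ γ' : Config V} {p : V}
    (hpar : G.Adj p (γ.par p)) (hd : γ'.d p = γ.d p) (h : execB G D γ γ' p) :
    γ.d (γ'.par p) < γ.d (γ.par p) := by
  have := minD_le_of_adj (γ := γ) hpar
  unfold execB dOk parOk at h
  omega

theorem execHC_par_lt {V : Type*} {G : SimpleGraph V} {D : ℕ} {γ γ' : Config V} {p : V}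
    (hd : γ'.d p = γ.d p) (h : execHC G D γ γ' p) :
    γ.d (γ'.par p) < γ.d (γ.par p) := by
  unfold execHC parOk at h
  omega

/-- If the `d`-values are eventually constant and every rule execution that keeps the
`d`-value moves the parent pointer to a vertex of smaller `d`-value, then the sum of the
`d`-values of the parents decreases forever, which is impossible. -/
theorem not_forall_step_of_par_lt {V : Type*} [Fintype V] {r : V}
    {exec : Config V → Config V → V → Prop} {e : ℕ → Config V}
    (hstep : ∀ i, Step r exec (e i) (e (i + 1)))
    (hlt : ∀ i, ∀ p ≠ r, (e (i + 1)).d p = (e i).d p → exec (e i) (e (i + 1)) p →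
      (e i).d ((e (i + 1)).par p) < (e i).d ((e i).par p))
    (hfin : ∀ p, ∃ N, ∀ i, N ≤ i → (e (i + 1)).d p = (e i).d p) :
    False := by
  choose N hN using hfin
  set K := Finset.univ.sup N
  have hK : ∀ i, K ≤ i → (e (i + 1)).d = (e i).d := fun i hi =>
    funext fun p => hN p i ((Finset.le_sup (Finset.mem_univ p)).trans hi)
  have hdec : ∀ n, ∑ p, (e (K + (n + 1))).d ((e (K + (n + 1))).par p) <
      ∑ p, (e (K + n)).d ((e (K + n)).par p) := by
    intro n
    have hd := hK (K + n) (Nat.le_add_right K n)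
    obtain ⟨S, ⟨p, hp⟩, hS, hS'⟩ := hstep (K + n)
    rw [← Nat.add_assoc, hd]
    have hmem : ∀ q ∈ S, (e (K + n)).d ((e (K + n + 1)).par q) <
        (e (K + n)).d ((e (K + n)).par q) := fun q hq =>
      hlt _ q (hS q hq).1 (congrFun hd q) (hS q hq).2
    refine Finset.sum_lt_sum (fun q _ => ?_) ⟨p, Finset.mem_univ p, hmem p hp⟩
    by_cases hq : q ∈ S
    · exact (hmem q hq).le
    · rw [(hS' q hq).2]
  exact (RelEmbedding.natGT _ hdec).not_wellFounded wellFounded_lt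

/-- Let `e = γ_0, γ_1, …` be an execution of `Algo_U`, of `Algo_B(D)`, or of
`Algo_HC(D)`. If for every vertex `p` the value `d p` is modified only a finite number
of times along `e`, then `e` is finite (equivalently: there is no such infinite
sequence of genuine steps). -/
theorem finitely_modified_d_implies_finite {V : Type*} [Fintype V]
    (G : SimpleGraph V) (hconn : G.Connected) (r : V) (e : ℕ → Config V)
    (halg :
      ((∀ i, ValidU G r (e i)) ∧ ∀ i, Step r (execU G) (e i) (e (i + 1))) ∨
      (∃ D, (∀ i, ValidB G r D (e i)) ∧
        ((∀ i, Step r (execB G D) (e i) (e (i + 1))) ∨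
         (∀ i, Step r (execHC G D) (e i) (e (i + 1))))))
    (hfin : ∀ p, ∃ N, ∀ i, N ≤ i → (e (i + 1)).d p = (e i).d p) :
    False := by
  rcases halg with ⟨hv, hs⟩ | ⟨D, hv, hs | hs⟩
  · exact not_forall_step_of_par_lt hs
      (fun i p hp hd h => execU_par_lt ((hv i).2 p hp) hd h) hfin
  · exact not_forall_step_of_par_lt hs
      (fun i p hp hd h => execB_par_lt ((hv i).2 p hp).1 hd h) hfin
  · exact not_forall_step_of_par_lt hs (fun _ _ _ hd h => execHC_par_lt hd h) hfin
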